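/- Let T be a densely defined self-adjoint operator on a complex Hilbert space H with bounded transform S, and let z ∈ ρ(T) = ℂ \ σ(T). For f(x) = (x - z)^{-1} on σ(T), the operator f₀(T) defined on C*_c(S)H by f₀(T) h(T)ψ = (fh)(T)ψ for h ∈ C_c(σ(T)) has closure equal to the resolvent (T - z)^{-1} ∈ B(H). -/

import Mathlib

noncomputable section

variable {H : Type*} [NormedAddCommGroup H] [InnerProductSpace ℂ H] [CompleteSpace H]

/-- `S = T(I + T²)^{-1/2}`, the *bounded transform* of the (possibly unbounded) operator `T`.
This is witnessed by `C = (I + T²)⁻¹` (a positive bounded operator mapping into the domain of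
`T²` with `(I + T²) ∘ C = I`, which determines `C` uniquely when `T` is self-adjoint) together
with its (unique) positive square root `R = (I + T²)^{-1/2}`, and `S = T ∘ R`. -/
def IsBoundedTransform (T : H →ₗ.[ℂ] H) (S : H →L[ℂ] H) : Prop :=
  ∃ C R : H →L[ℂ] H, C.IsPositive ∧ R.IsPositive ∧ R * R = C ∧
    (∀ x : H, ∃ (h1 : C x ∈ T.domain) (h2 : (T ⟨C x, h1⟩ : H) ∈ T.domain),
        C x + T ⟨(T ⟨C x, h1⟩ : H), h2⟩ = x) ∧
    (∀ x : H, ∃ hx : R x ∈ T.domain, S x = T ⟨R x, hx⟩)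

/-- `S` is a pure contraction: `‖Sx‖ < ‖x‖` for all `x ≠ 0`. -/
def PureContraction (S : H →L[ℂ] H) : Prop := ∀ x : H, x ≠ 0 → ‖S x‖ < ‖x‖

/-- `T = S(I - S²)^{-1/2}`: witnessed by the (unique) positive square root `R` of `I - S²`,
with `D(T) = ran R` and `T ∘ R = S`. -/
def IsInverseBoundedTransform (S : H →L[ℂ] H) (T : H →ₗ.[ℂ] H) : Prop :=
  ∃ R : H →L[ℂ] H, R.IsPositive ∧ R * R = 1 - S * S ∧
    (T.domain : Set H) = Set.range R ∧
    (∀ x : H, ∃ hx : R x ∈ T.domain, (T ⟨R x, hx⟩ : H) = S x)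

/-- The resolvent set of an unbounded operator: `z` such that `T - z` has a (bounded,
everywhere defined) two-sided inverse. -/
def pmapResolventSet (T : H →ₗ.[ℂ] H) : Set ℂ :=
  {z | ∃ B : H →L[ℂ] H,
    (∀ x : H, ∃ h : B x ∈ T.domain, (T ⟨B x, h⟩ : H) - z • B x = x) ∧
    (∀ ψ : T.domain, B ((T ψ : H) - z • (ψ : H)) = ψ)}

/-- The spectrum of an unbounded operator. -/
def pmapSpectrum (T : H →ₗ.[ℂ] H) : Set ℂ := (pmapResolventSet T)ᶜ

/-- The real points of the spectrum of `T` (all of them, if `T` is self-adjoint). -/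
def realSpec (T : H →ₗ.[ℂ] H) : Set ℝ := {x : ℝ | (x : ℂ) ∈ pmapSpectrum T}

/-- `g(S)` for a function `g : ℝ → ℂ`, via the continuous functional calculus of `S`. -/
def boundedCalc (S : H →L[ℂ] H) (g : ℝ → ℂ) : H →L[ℂ] H :=
  cfc (fun z : ℂ => g z.re) S

/-- The homeomorphism `u : (-1,1) → ℝ`, `u(x) = x(1 - x²)^{-1/2}`. -/
def uFun : ℝ → ℝ := fun x => x / Real.sqrt (1 - x ^ 2)

/-- `h ∘ u`, extended by `0` outside `(-1,1)`. -/
def compU (h : ℝ → ℂ) : ℝ → ℂ :=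
  fun x => if x ∈ Set.Ioo (-1 : ℝ) 1 then h (uFun x) else 0

/-- `h(T) := (h ∘ u)(S)`, for a function `h` on `σ(T)`, where `S` is the bounded
transform of `T`. -/
def pmapCalc (S : H →L[ℂ] H) (h : ℝ → ℂ) : H →L[ℂ] H := boundedCalc S (compU h)

/-- `σ̃(S) = σ(S) ∩ (-1,1)`. -/
def tildeSpec (S : H →L[ℂ] H) : Set ℝ := spectrum ℝ S ∩ Set.Ioo (-1) 1

/-- `g ∈ C_c(Ω)`: continuous on `Ω`, vanishing outside a compact subset of `Ω`
(functions on `Ω` are encoded as functions on `ℝ` vanishing identically outside `Ω`). -/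
def MemCc (g : ℝ → ℂ) (Ω : Set ℝ) : Prop :=
  ContinuousOn g Ω ∧ ∃ K : Set ℝ, IsCompact K ∧ K ⊆ Ω ∧ ∀ x ∉ K, g x = 0

/-- `g ∈ C₀(Ω)`: continuous on `Ω` and vanishing at infinity on `Ω`. -/
def MemC0 (g : ℝ → ℂ) (Ω : Set ℝ) : Prop :=
  ContinuousOn g Ω ∧ (∀ x ∉ Ω, g x = 0) ∧
    ∀ ε > 0, ∃ K : Set ℝ, IsCompact K ∧ K ⊆ Ω ∧ ∀ x ∈ Ω \ K, ‖g x‖ < ε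

/-- `g ∈ C_b(Ω)`: continuous and bounded on `Ω`. -/
def MemCb (g : ℝ → ℂ) (Ω : Set ℝ) : Prop :=
  ContinuousOn g Ω ∧ ∃ M : ℝ, ∀ x ∈ Ω, ‖g x‖ ≤ M

/-- The supremum norm `‖f‖_∞` of `f` over `Ω`. -/
def supNorm (f : ℝ → ℂ) (Ω : Set ℝ) : ℝ := sSup ((fun x => ‖f x‖) '' Ω)

/-- The subspace `C*_c(S)H`: the linear span of all `g(S)ψ` with `g ∈ C_c(σ̃(S))`. -/
def ccSpan (S : H →L[ℂ] H) : Submodule ℂ H :=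
  Submodule.span ℂ
    {v : H | ∃ g : ℝ → ℂ, MemCc g (tildeSpec S) ∧ ∃ ψ : H, v = boundedCalc S g ψ}

/-- The subspace `C*₀(S)H`: the linear span of all `g(S)ψ` with `g ∈ C₀(σ̃(S))`. -/
def c0Span (S : H →L[ℂ] H) : Submodule ℂ H :=
  Submodule.span ℂ
    {v : H | ∃ g : ℝ → ℂ, MemC0 g (tildeSpec S) ∧ ∃ ψ : H, v = boundedCalc S g ψ}

/-- `TR ⊂ RT`: the bounded operator `R` commutes with the unbounded operator `T`. -/
def CommutesPMap (T : H →ₗ.[ℂ] H) (R : H →L[ℂ] H) : Prop :=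
  ∀ ψ : T.domain, ∃ h : R (ψ : H) ∈ T.domain, (T ⟨R (ψ : H), h⟩ : H) = R (T ψ)

/-- `A = f₀(T)`: the operator with domain `C*_c(S)H` determined by
`f₀(T) h(T)ψ = (fh)(T)ψ` for `h ∈ C_c(σ(T))` (where `σT` is the spectrum of `T`,
and `h(T) = (h∘u)(S)`). -/
def IsF0 (S : H →L[ℂ] H) (σT : Set ℝ) (f : ℝ → ℂ) (A : H →ₗ.[ℂ] H) : Prop :=
  A.domain = ccSpan S ∧
  ∀ h : ℝ → ℂ, MemCc h σT → ∀ ψ : H,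
    ∃ hm : pmapCalc S h ψ ∈ A.domain,
      A ⟨pmapCalc S h ψ, hm⟩ = pmapCalc S (fun x => f x * h x) ψ

open scoped InnerProductSpace

/-- A self-adjoint partially defined operator is symmetric, expressed on its graph. -/
theorem LinearPMap.inner_eq_of_mem_graph {T : H →ₗ.[ℂ] H} (hsa : IsSelfAdjoint T)
    {x x' y y' : H} (hx : (x, x') ∈ T.graph) (hy : (y, y') ∈ T.graph) :
    ⟪x', y⟫_ℂ = ⟪x, y'⟫_ℂ := by
  have h := LinearPMap.adjoint_isFormalAdjoint (T := T) hsa.dense_domain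
  rw [LinearPMap.isSelfAdjoint_def.1 hsa] at h
  obtain ⟨a, rfl, rfl⟩ := (LinearPMap.mem_graph_iff T).1 hx
  obtain ⟨b, rfl, rfl⟩ := (LinearPMap.mem_graph_iff T).1 hy
  exact h a b

/-- The algebraic relations satisfied by the bounded transform `S = T R` of a self-adjoint
operator `T`, where `R = (I + T²)^{-1/2}`. -/
structure BoundedTransformData (T : H →ₗ.[ℂ] H) (S R : H →L[ℂ] H) : Prop where
  isSelfAdjoint : IsSelfAdjoint S
  nonneg : 0 ≤ R
  mul_self : R * R = 1 - S * S
  injective : ∀ x, R x = 0 → x = 0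
  mem_graph : ∀ x, (R x, S x) ∈ T.graph

theorem IsBoundedTransform.exists_data {T : H →ₗ.[ℂ] H} {S : H →L[ℂ] H}
    (hsa : IsSelfAdjoint T) (hbt : IsBoundedTransform T S) :
    ∃ R : H →L[ℂ] H, BoundedTransformData T S R := by
  obtain ⟨C, R, -, hRpos, rfl, hCT, hRT⟩ := hbt
  have hR0 : 0 ≤ R := (ContinuousLinearMap.nonneg_iff_isPositive R).2 hRpos
  have hRsa : star R = R := hRpos.isSelfAdjoint
  have hRS : ∀ x, (R x, S x) ∈ T.graph := fun x => by
    obtain ⟨h, e⟩ := hRT x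
    exact (LinearPMap.mem_graph_iff T).2 ⟨⟨R x, h⟩, rfl, e.symm⟩
  set D := S * R with hD
  set C := R * R with hC
  have hCD : ∀ x, (C x, D x) ∈ T.graph := fun x => hRS (R x)
  have hDC : ∀ x, (D x, x - C x) ∈ T.graph := fun x => by
    obtain ⟨h1, h2, e⟩ := hCT x
    obtain ⟨h3, e3⟩ := hRT (R x)
    have e4 : T ⟨C x, h1⟩ = D x := e3.symm
    refine (LinearPMap.mem_graph_iff T).2 ⟨⟨_, h2⟩, e4, ?_⟩
    exact eq_sub_of_add_eq' e
  have hCsymm : ∀ x y, ⟪C x, y⟫_ℂ = ⟪x, C y⟫_ℂ := by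
    have hCsa : IsSelfAdjoint C := by
      rw [IsSelfAdjoint, hC, star_mul, hRsa]
    exact hCsa.isSymmetric
  have hDsymm : ∀ x y, ⟪D x, y⟫_ℂ = ⟪x, D y⟫_ℂ := fun x y => by
    have h1 := LinearPMap.inner_eq_of_mem_graph hsa (hDC x) (hDC y)
    have h2 := LinearPMap.inner_eq_of_mem_graph hsa (hCD x) (hCD y)
    rw [inner_sub_left, inner_sub_right] at h1
    linear_combination h2 - h1
  have hDsa : IsSelfAdjoint D := by
    rw [ContinuousLinearMap.isSelfAdjoint_iff_isSymmetric]
    exact hDsymm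
  have hDD : ∀ x, D (D x) = C x - C (C x) := fun x => by
    refine ext_inner_right ℂ fun y => ?_
    rw [hDsymm, ← LinearPMap.inner_eq_of_mem_graph hsa (hDC x) (hCD y), ← hCsymm, map_sub]
  have hcomm : Commute C D := by
    ext x
    have hw : (D (C x) - C (D x), 0) ∈ T.graph := by
      have := T.graph.sub_mem (hDC (C x)) (hCD (D x))
      rwa [Prod.mk_sub_mk, hDD, sub_self] at this
    set w := D (C x) - C (D x) with hwdef
    have h1 : D w = 0 := ext_inner_right ℂ fun y => by
      rw [hDsymm, ← LinearPMap.inner_eq_of_mem_graph hsa hw (hCD y)]; simp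
    have h2 : C w = w := ext_inner_right ℂ fun y => by
      have := LinearPMap.inner_eq_of_mem_graph hsa hw (hDC y)
      rw [inner_sub_right, inner_zero_left] at this
      rw [hCsymm]
      linear_combination this
    have h3 : ⟪w, w⟫_ℂ = 0 := by
      nth_rewrite 2 [hwdef]
      rw [inner_sub_right, ← hDsymm, ← hCsymm w, h1, h2, ← hDsymm, h1]
      simp
    have h4 := inner_self_eq_zero.1 h3
    exact (sub_eq_zero.1 h4).symm
  have hRinj : ∀ x, R x = 0 → x = 0 := fun x hx => by
    have h := hDC x
    have e1 : D x = 0 := by simp [hD, hx]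
    have e2 : C x = 0 := by simp [hC, hx]
    rw [e1, e2, sub_zero] at h
    exact T.graph_fst_eq_zero_snd h rfl
  have cancel_left : ∀ A B : H →L[ℂ] H, R * A = R * B → A = B := fun A B h => by
    ext x
    refine sub_eq_zero.1 (hRinj _ ?_)
    rw [map_sub, sub_eq_zero]
    exact congrArg (fun f => f x) h
  have cancel_right : ∀ A B : H →L[ℂ] H, A * R = B * R → A = B := fun A B h => by
    have := congrArg star h
    rw [star_mul, star_mul, hRsa] at this
    exact star_injective (cancel_left _ _ this)
  have hRD : Commute R D := by
    have : CFC.sqrt C = R := CFC.sqrt_unique rfl hR0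
    rw [← this]
    exact hcomm.cfcₙ_nnreal _
  have hSR : Commute S R := cancel_right _ _ (by
    rw [← hD, ← hRD.eq, hD, mul_assoc])
  have hSsa : IsSelfAdjoint S := cancel_left _ _ (by
    have := hDsa.star_eq
    rw [hD, star_mul, hRsa] at this
    rw [this, hSR.eq])
  refine ⟨R, hSsa, hR0, ?_, hRinj, hRS⟩
  have h1 : D * D = C - C * C := ContinuousLinearMap.ext hDD
  have h2 : S * S = 1 - R * R := cancel_left _ _ (cancel_right _ _ (by
    calc R * (S * S) * R = (R * S) * (S * R) := by simp only [mul_assoc]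
      _ = D * D := by rw [← hSR.eq]
      _ = R * (1 - R * R) * R := by rw [h1, hC]; noncomm_ring))
  rw [h2, sub_sub_cancel]

section boundedCalc

variable {S : H →L[ℂ] H} {f g : ℝ → ℂ}

theorem IsSelfAdjoint.re_mem_spectrum_real (hS : IsSelfAdjoint S) {w : ℂ}
    (hw : w ∈ spectrum ℂ S) : w.re ∈ spectrum ℝ S := by
  rw [← spectrum.algebraMap_mem_iff ℂ]
  have := hS.mem_spectrum_eq_re hw
  rw [this] at hw
  exact hw

theorem IsSelfAdjoint.continuousOn_comp_re (hS : IsSelfAdjoint S)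
    (hf : ContinuousOn f (spectrum ℝ S)) :
    ContinuousOn (fun w : ℂ => f w.re) (spectrum ℂ S) :=
  hf.comp Complex.continuous_re.continuousOn fun _ hw => hS.re_mem_spectrum_real hw

theorem boundedCalc_congr (hS : IsSelfAdjoint S) (h : Set.EqOn f g (spectrum ℝ S)) :
    boundedCalc S f = boundedCalc S g :=
  cfc_congr fun _ hw => h (hS.re_mem_spectrum_real hw)

theorem boundedCalc_mul (hS : IsSelfAdjoint S) (hf : ContinuousOn f (spectrum ℝ S))
    (hg : ContinuousOn g (spectrum ℝ S)) :
    boundedCalc S (fun x => f x * g x) = boundedCalc S f * boundedCalc S g :=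
  cfc_mul _ _ S (hS.continuousOn_comp_re hf) (hS.continuousOn_comp_re hg)

theorem boundedCalc_sub (hS : IsSelfAdjoint S) (hf : ContinuousOn f (spectrum ℝ S))
    (hg : ContinuousOn g (spectrum ℝ S)) :
    boundedCalc S (fun x => f x - g x) = boundedCalc S f - boundedCalc S g :=
  cfc_sub _ _ S (hS.continuousOn_comp_re hf) (hS.continuousOn_comp_re hg)

theorem boundedCalc_const_mul (hS : IsSelfAdjoint S) (c : ℂ)
    (hf : ContinuousOn f (spectrum ℝ S)) :
    boundedCalc S (fun x => c * f x) = c • boundedCalc S f :=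
  cfc_const_mul c _ S (hS.continuousOn_comp_re hf)

theorem boundedCalc_ofReal (hS : IsSelfAdjoint S) (p : ℝ → ℝ) :
    boundedCalc S (fun x => (p x : ℂ)) = cfc p S :=
  (cfc_real_eq_complex p hS).symm

theorem boundedCalc_id (hS : IsSelfAdjoint S) : boundedCalc S (fun x => (x : ℂ)) = S := by
  rw [boundedCalc_ofReal hS (fun x => x), cfc_id' ℝ S]

theorem norm_boundedCalc_le (hS : IsSelfAdjoint S) {c : ℝ} (hc : 0 ≤ c)
    (h : ∀ x ∈ spectrum ℝ S, ‖f x‖ ≤ c) : ‖boundedCalc S f‖ ≤ c :=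
  norm_cfc_le hc fun _ hw => h _ (hS.re_mem_spectrum_real hw)

theorem isUnit_boundedCalc (hS : IsSelfAdjoint S) (hf : ContinuousOn f (spectrum ℝ S))
    (h : ∀ x ∈ spectrum ℝ S, f x ≠ 0) : IsUnit (boundedCalc S f) :=
  (isUnit_cfc_iff _ S (hS.continuousOn_comp_re hf) hS.isStarNormal).2
    fun _ hw => h _ (hS.re_mem_spectrum_real hw)

/-- A function in `C_c(σ̃(S))` is continuous on all of `σ(S)`. -/
theorem MemCc.continuousOn_spectrum (hg : MemCc g (tildeSpec S)) :
    ContinuousOn g (spectrum ℝ S) := by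
  obtain ⟨hc, K, hK, hKs, h0⟩ := hg
  intro x hx
  by_cases hxK : x ∈ K
  · have h1 := hc x (hKs hxK)
    rw [tildeSpec, continuousWithinAt_inter (Ioo_mem_nhds (hKs hxK).2.1 (hKs hxK).2.2)] at h1
    exact h1
  · refine ContinuousAt.continuousWithinAt ?_
    have : g =ᶠ[nhds x] fun _ => 0 := by
      filter_upwards [hK.isClosed.isOpen_compl.mem_nhds hxK] with y hy using h0 y hy
    exact this.continuousAt

end boundedCalc

namespace BoundedTransformData

variable {T : H →ₗ.[ℂ] H} {S R : H →L[ℂ] H}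

theorem notMem_realSpec_iff {x : ℝ} : x ∉ realSpec T ↔ (x : ℂ) ∈ pmapResolventSet T :=
  not_not

theorem sq_le_one (h : BoundedTransformData T S R) {x : ℝ} (hx : x ∈ spectrum ℝ S) :
    0 ≤ 1 - x ^ 2 := by
  have hS := h.isSelfAdjoint
  have e : cfc (fun x : ℝ => 1 - x ^ 2) S = R * R := by
    rw [h.mul_self, cfc_sub (fun _ => (1 : ℝ)) (fun x => x ^ 2) S, cfc_const_one ℝ S,
      cfc_pow_id S 2, pow_two]
  have h0 : 0 ≤ cfc (fun x : ℝ => 1 - x ^ 2) S := by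
    rw [e]
    nth_rewrite 1 [← (IsSelfAdjoint.of_nonneg h.nonneg).star_eq]
    exact star_mul_self_nonneg R
  exact (cfc_nonneg_iff _ S).1 h0 x hx

theorem eq_boundedCalc (h : BoundedTransformData T S R) :
    boundedCalc S (fun x => (√(1 - x ^ 2) : ℂ)) = R := by
  have hS := h.isSelfAdjoint
  rw [boundedCalc_ofReal hS (fun x => √(1 - x ^ 2))]
  have e : cfc (fun x : ℝ => √(1 - x ^ 2)) S * cfc (fun x : ℝ => √(1 - x ^ 2)) S
      = R * R := by
    rw [← cfc_mul _ _ S, h.mul_self, ← pow_two, ← cfc_pow_id (R := ℝ) S 2,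
      ← cfc_const_one ℝ S, ← cfc_sub (fun _ => (1 : ℝ)) (fun x => x ^ 2) S]
    exact cfc_congr fun x hx => Real.mul_self_sqrt (h.sq_le_one hx)
  have h1 := CFC.sqrt_unique e (cfc_nonneg fun x _ => Real.sqrt_nonneg _)
  rw [← h1]
  exact CFC.sqrt_unique rfl h.nonneg

/-- `S - zR` is the function `x ↦ x - z√(1 - x²)` of `S`. -/
theorem boundedCalc_sub_smul (h : BoundedTransformData T S R) (z : ℂ) :
    boundedCalc S (fun x => (x : ℂ) - z * (√(1 - x ^ 2) : ℂ)) = S - z • R := by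
  have hS := h.isSelfAdjoint
  rw [boundedCalc_sub hS (by fun_prop) (by fun_prop), boundedCalc_id hS,
    boundedCalc_const_mul hS z (by fun_prop), h.eq_boundedCalc]

/-- A left inverse `B` of `T - z` satisfies `B (S - zR) = R`. -/
theorem leftInverse_mul (h : BoundedTransformData T S R) {z : ℂ} {B : H →L[ℂ] H}
    (hB : ∀ ψ : T.domain, B ((T ψ : H) - z • (ψ : H)) = ψ) : B * (S - z • R) = R := by
  ext x
  obtain ⟨ψ, e1, e2⟩ := (LinearPMap.mem_graph_iff T).1 (h.mem_graph x)
  have := hB ψ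
  rw [e1, e2] at this
  exact this

theorem notMem_realSpec (h : BoundedTransformData T S R) (hsa : IsSelfAdjoint T) {x : ℝ}
    (hx : x ∈ Set.Ioo (-1 : ℝ) 1) (hxS : x ∉ spectrum ℝ S) : uFun x ∉ realSpec T := by
  have hS := h.isSelfAdjoint
  have hs : 0 < √(1 - x ^ 2) := Real.sqrt_pos.2 (by nlinarith [hx.1, hx.2])
  have hs2 : √(1 - x ^ 2) ^ 2 = 1 - x ^ 2 := Real.sq_sqrt (by nlinarith [hx.1, hx.2])
  set l : ℝ := uFun x with hl
  have hlx : l * √(1 - x ^ 2) = x := by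
    rw [hl, uFun]; field_simp
  have hu : IsUnit (S - (l : ℂ) • R) := by
    rw [← h.boundedCalc_sub_smul]
    refine isUnit_boundedCalc hS (by fun_prop) fun t ht h0 => hxS ?_
    have h1 : t - l * √(1 - t ^ 2) = 0 := by exact_mod_cast h0
    have h2 := h.sq_le_one ht
    have h3 := Real.sq_sqrt h2
    have h4 := Real.sqrt_nonneg (1 - t ^ 2)
    set s := √(1 - t ^ 2)
    set c := √(1 - x ^ 2)
    have h5 : c * t = x * s := by rw [← hlx]; linear_combination c * h1
    have h6 : s ^ 2 = c ^ 2 := by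
      have : (c * t) ^ 2 = (x * s) ^ 2 := by rw [h5]
      linear_combination c ^ 2 * h3 - s ^ 2 * hs2 - this
    have h7 : s = c := by nlinarith
    have h8 : t = x := by
      rw [h7] at h5
      exact mul_left_cancel₀ hs.ne' (by linarith)
    exact h8 ▸ ht
  obtain ⟨L, hL1, hL2⟩ := isUnit_iff_exists.1 hu
  have hres : ∀ y, (R (L y), y + (l : ℂ) • R (L y)) ∈ T.graph := fun y => by
    have h1 := h.mem_graph (L y)
    have h2 : S (L y) - (l : ℂ) • R (L y) = y := congrArg (fun f => f y) hL1
    rwa [← sub_eq_iff_eq_add.1 h2]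
  refine notMem_realSpec_iff.2 ⟨R * L, fun y => ?_, fun ψ => ?_⟩
  · obtain ⟨v, e1, e2⟩ := (LinearPMap.mem_graph_iff T).1 (hres y)
    obtain ⟨v, hv⟩ := v
    obtain rfl : v = (R * L) y := e1
    refine ⟨hv, ?_⟩
    rw [e2]
    exact add_sub_cancel_right _ _
  · have h1 := T.graph.sub_mem (hres ((T ψ : H) - (l : ℂ) • (ψ : H))) (T.mem_graph ψ)
    set w := R (L ((T ψ : H) - (l : ℂ) • (ψ : H))) - ψ with hw
    have h2 : (w, (l : ℂ) • w) ∈ T.graph := by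
      convert h1 using 1
      refine Prod.ext rfl ?_
      simp only [hw, Prod.snd_sub]
      module
    have h3 := LinearPMap.inner_eq_of_mem_graph hsa h2 (hres w)
    rw [inner_add_right, inner_smul_left, inner_smul_right, Complex.conj_ofReal] at h3
    have h4 : ⟪w, w⟫_ℂ = 0 := by linear_combination -h3
    exact sub_eq_zero.1 (inner_self_eq_zero.1 h4)

theorem notMem_spectrum (h : BoundedTransformData T S R) {x : ℝ}
    (hx : x ∈ Set.Ioo (-1 : ℝ) 1) (hxT : uFun x ∉ realSpec T) : x ∉ spectrum ℝ S := by
  have hS := h.isSelfAdjoint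
  have hs : 0 < √(1 - x ^ 2) := Real.sqrt_pos.2 (by nlinarith [hx.1, hx.2])
  have hs2 : √(1 - x ^ 2) ^ 2 = 1 - x ^ 2 := Real.sq_sqrt (by nlinarith [hx.1, hx.2])
  obtain ⟨B, -, hB⟩ := notMem_realSpec_iff.1 hxT
  have hBM := h.leftInverse_mul hB
  set c := √(1 - x ^ 2) with hc
  set l : ℝ := uFun x with hl
  have hlx : l * c = x := by
    rw [hl, uFun, ← hc]; field_simp
  obtain ⟨L, hL⟩ : ∃ L : H →L[ℂ] H, ∀ v, L (R v + c • v) = v := by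
    have hu : IsUnit (R - (-c : ℂ) • 1) := by
      have e : boundedCalc S (fun t => (√(1 - t ^ 2) : ℂ) - (-c : ℂ) * 1) = R - (-c : ℂ) • 1 := by
        rw [boundedCalc_sub hS (by fun_prop) (by fun_prop), h.eq_boundedCalc,
          boundedCalc_const_mul hS (f := fun _ => 1) _ (by fun_prop), boundedCalc,
          cfc_const_one ℂ S hS.isStarNormal]
      rw [← e]
      refine isUnit_boundedCalc hS (by fun_prop) fun t _ h0 => ?_
      have h1 : √(1 - t ^ 2) - (-c) * 1 = 0 := by exact_mod_cast h0
      have := Real.sqrt_nonneg (1 - t ^ 2)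
      linarith
    obtain ⟨L, -, hL⟩ := isUnit_iff_exists.1 hu
    refine ⟨L, fun v => ?_⟩
    have h1 := congrArg (fun f => f v) hL
    simpa [neg_smul] using h1
  have hRR : ∀ v, R (R v) = v - S (S v) := fun v => congrArg (fun f => f v) h.mul_self
  have hBMv : ∀ v, B (S v - l • R v) = R v := fun v => congrArg (fun f => f v) hBM
  have hLv : ∀ v, R v - c • v = - L (S (S v - x • v) + x • (S v - x • v)) := fun v => by
    rw [← hL (R v - c • v), ← map_neg]
    congr 1
    simp only [map_sub, hRR, ContinuousLinearMap.map_smul_of_tower]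
    have : v = (c ^ 2 + x ^ 2) • v := by rw [hs2]; simp
    linear_combination (norm := module) this
  set P : H →L[ℂ] H := L * (S + x • 1) with hP
  have hLP : ∀ v, R v - c • v = - P (S v - x • v) := hLv
  set A : H →L[ℂ] H := c⁻¹ • (B * (1 + l • P) + P) with hA
  have hAv : ∀ v, A (S v - x • v) = v := fun v => by
    have h1 : S v - l • R v = S v - x • v + l • P (S v - x • v) := by
      rw [← neg_neg (P _), ← hLP, ← hlx]
      module
    have h2 : A (S v - x • v) = c⁻¹ • (B (S v - l • R v) + P (S v - x • v)) := by
      rw [h1]; rfl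
    rw [h2, hBMv, ← neg_neg (P _), ← hLP]
    simp [hs.ne']
  have hA1 : A * (S - algebraMap ℝ _ x) = 1 := by
    ext v
    rw [Algebra.algebraMap_eq_smul_one]
    exact hAv v
  have hA2 : (S - algebraMap ℝ _ x) * star A = 1 := by
    have := congrArg star hA1
    rwa [star_mul, star_sub, hS.star_eq, star_one,
      (IsSelfAdjoint.algebraMap (H →L[ℂ] H) (IsSelfAdjoint.all x)).star_eq] at this
  have hu : IsUnit (S - algebraMap ℝ (H →L[ℂ] H) x) :=
    isUnit_iff_exists_and_exists.2 ⟨⟨_, hA2⟩, ⟨_, hA1⟩⟩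
  rw [spectrum.notMem_iff, ← neg_sub]
  exact hu.neg

theorem mem_spectrum_iff (h : BoundedTransformData T S R) (hsa : IsSelfAdjoint T) {x : ℝ}
    (hx : x ∈ Set.Ioo (-1 : ℝ) 1) : x ∈ spectrum ℝ S ↔ uFun x ∈ realSpec T :=
  not_iff_not.1 ⟨h.notMem_realSpec hsa hx, h.notMem_spectrum hx⟩

theorem mul_self_mem_closure_ccSpan (h : BoundedTransformData T S R) (v : H) :
    R (R v) ∈ closure (ccSpan S : Set H) := by
  classical
  have hS := h.isSelfAdjoint
  rw [Metric.mem_closure_iff]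
  intro ε hε
  set δ : ℝ := ε / (2 * (‖v‖ + 1)) with hδ
  have hv : 0 < ‖v‖ + 1 := by positivity
  have hδ0 : 0 < δ := by positivity
  set k : ℝ → ℂ := fun x => ((max (1 - x ^ 2 - δ) 0 : ℝ) : ℂ) with hk
  have hkc : Continuous k := by fun_prop
  set g : ℝ → ℂ := (spectrum ℝ S).indicator k with hg
  have hgk : Set.EqOn g k (spectrum ℝ S) := fun x hx => Set.indicator_of_mem hx _
  have hgm : MemCc g (tildeSpec S) := by
    refine ⟨(hkc.continuousOn.congr hgk).mono Set.inter_subset_left,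
      spectrum ℝ S ∩ {x | δ ≤ 1 - x ^ 2}, ?_, ?_, ?_⟩
    · exact (spectrum.isCompact S).inter_right
        (isClosed_le continuous_const (by fun_prop))
    · rintro x ⟨hx, hx2⟩
      have hx3 : δ ≤ 1 - x ^ 2 := hx2
      exact ⟨hx, by nlinarith, by nlinarith⟩
    · intro x hx
      by_cases hxs : x ∈ spectrum ℝ S
      · have hx2 : ¬ δ ≤ 1 - x ^ 2 := fun hd => hx ⟨hxs, hd⟩
        rw [hgk hxs, hk]
        simp only [Complex.ofReal_eq_zero]
        exact max_eq_right (by linarith)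
      · exact Set.indicator_of_notMem hxs _
  have hRR : R * R = boundedCalc S (fun x => (√(1 - x ^ 2) : ℂ) * (√(1 - x ^ 2) : ℂ)) := by
    rw [boundedCalc_mul hS (by fun_prop) (by fun_prop), h.eq_boundedCalc]
  have hnorm : ‖R * R - boundedCalc S g‖ ≤ δ := by
    rw [hRR, ← boundedCalc_sub hS (by fun_prop) hgm.continuousOn_spectrum]
    refine norm_boundedCalc_le hS hδ0.le fun x hx => ?_
    have h1 := h.sq_le_one hx
    rw [hgk hx, hk, ← Complex.ofReal_mul, ← Complex.ofReal_sub, Complex.norm_real,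
      Real.mul_self_sqrt h1, Real.norm_eq_abs, abs_le]
    constructor
    · have := max_le (a := 1 - x ^ 2 - δ) (b := 0) (c := 1 - x ^ 2) (by linarith) h1
      linarith
    · linarith [le_max_left (1 - x ^ 2 - δ) 0]
  refine ⟨boundedCalc S g v, Submodule.subset_span ⟨g, hgm, v, rfl⟩, ?_⟩
  calc dist (R (R v)) (boundedCalc S g v) = ‖(R * R - boundedCalc S g) v‖ := dist_eq_norm _ _
    _ ≤ δ * ‖v‖ := ContinuousLinearMap.le_of_opNorm_le _ hnorm v
    _ < ε := by
      rw [hδ, div_mul_eq_mul_div, div_lt_iff₀ (by positivity)]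
      nlinarith [norm_nonneg v]

theorem dense_ccSpan (h : BoundedTransformData T S R) : Dense (ccSpan S : Set H) := by
  rw [Submodule.dense_iff_topologicalClosure_eq_top,
    Submodule.topologicalClosure_eq_top_iff, Submodule.eq_bot_iff]
  intro w hw
  rw [← Submodule.orthogonal_closure] at hw
  have hRsymm : (R : H →ₗ[ℂ] H).IsSymmetric :=
    (IsSelfAdjoint.of_nonneg h.nonneg).isSymmetric
  have h1 : ⟪R (R w), w⟫_ℂ = 0 :=
    (Submodule.mem_orthogonal _ _).1 hw _ (h.mul_self_mem_closure_ccSpan w)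
  have h2 : ⟪R w, R w⟫_ℂ = 0 := by rw [← h1]; exact (hRsymm (R w) w).symm
  exact h.injective _ (inner_self_eq_zero.1 h2)

theorem uFun_div_sqrt (y : ℝ) :
    y / √(1 + y ^ 2) ∈ Set.Ioo (-1 : ℝ) 1 ∧ uFun (y / √(1 + y ^ 2)) = y := by
  have hp : 0 < 1 + y ^ 2 := by positivity
  have hs : 0 < √(1 + y ^ 2) := Real.sqrt_pos.2 hp
  have hs2 := Real.sq_sqrt hp.le
  refine ⟨?_, ?_⟩
  · rw [Set.mem_Ioo, ← abs_lt, ← sq_lt_one_iff_abs_lt_one, div_pow, hs2, div_lt_one hp]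
    linarith
  · have : 1 - (y / √(1 + y ^ 2)) ^ 2 = (√(1 + y ^ 2))⁻¹ ^ 2 := by
      rw [div_pow, inv_pow, hs2]; field_simp; ring
    rw [uFun, this, Real.sqrt_sq (by positivity)]
    field_simp

theorem div_sqrt_uFun {x : ℝ} (hx : x ∈ Set.Ioo (-1 : ℝ) 1) :
    uFun x / √(1 + uFun x ^ 2) = x := by
  have hp : 0 < 1 - x ^ 2 := by nlinarith [hx.1, hx.2]
  have hs : 0 < √(1 - x ^ 2) := Real.sqrt_pos.2 hp
  have hs2 := Real.sq_sqrt hp.le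
  have : 1 + uFun x ^ 2 = (√(1 - x ^ 2))⁻¹ ^ 2 := by
    rw [uFun, div_pow, inv_pow, hs2]; field_simp; ring
  rw [this, Real.sqrt_sq (by positivity), uFun]
  field_simp

theorem continuousOn_uFun : ContinuousOn uFun (Set.Ioo (-1) 1) := by
  refine ContinuousOn.div (by fun_prop) (by fun_prop) fun x hx => ?_
  exact (Real.sqrt_pos.2 (by nlinarith [hx.1, hx.2])).ne'

theorem memCc_compU (h : BoundedTransformData T S R) (hsa : IsSelfAdjoint T) {p : ℝ → ℂ}
    (hp : MemCc p (realSpec T)) : MemCc (compU p) (tildeSpec S) := by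
  obtain ⟨hc, K, hK, hKs, h0⟩ := hp
  refine ⟨?_, (fun y : ℝ => y / √(1 + y ^ 2)) '' K, hK.image ?_, ?_, ?_⟩
  · have h1 : ContinuousOn (fun x => p (uFun x)) (tildeSpec S) :=
      hc.comp (continuousOn_uFun.mono Set.inter_subset_right)
        fun x hx => (h.mem_spectrum_iff hsa hx.2).1 hx.1
    exact h1.congr fun x hx => if_pos hx.2
  · refine continuous_id.div (by fun_prop) fun y => ?_
    positivity
  · rintro _ ⟨y, hy, rfl⟩
    obtain ⟨h1, h2⟩ := uFun_div_sqrt y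
    exact ⟨(h.mem_spectrum_iff hsa h1).2 (h2.symm ▸ hKs hy), h1⟩
  · intro x hx
    by_cases hxI : x ∈ Set.Ioo (-1 : ℝ) 1
    · rw [compU, if_pos hxI]
      exact h0 _ fun hu => hx ⟨uFun x, hu, div_sqrt_uFun hxI⟩
    · exact if_neg hxI

/-- A left inverse of `T - z` acts on the range of `p(T)` as multiplication of `p` by
`(x - z)⁻¹`. -/
theorem leftInverse_mul_pmapCalc (h : BoundedTransformData T S R) (hsa : IsSelfAdjoint T)
    {z : ℂ} (hz : z ∉ pmapSpectrum T) {B : H →L[ℂ] H}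
    (hB : ∀ ψ : T.domain, B ((T ψ : H) - z • (ψ : H)) = ψ)
    {p : ℝ → ℂ} (hp : MemCc p (realSpec T)) :
    B * pmapCalc S p = pmapCalc S (fun x => ((x : ℂ) - z)⁻¹ * p x) := by
  have hS := h.isSelfAdjoint
  have hm := h.memCc_compU hsa hp
  set d : ℝ → ℂ := fun x => (x : ℂ) - z * (√(1 - x ^ 2) : ℂ) with hd
  have hdc : Continuous d := by fun_prop
  have hd_eq : ∀ x ∈ Set.Ioo (-1 : ℝ) 1, d x = √(1 - x ^ 2) * ((uFun x : ℂ) - z) := by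
    intro x hx
    have hs : (√(1 - x ^ 2) : ℂ) ≠ 0 :=
      Complex.ofReal_ne_zero.2 (Real.sqrt_pos.2 (by nlinarith [hx.1, hx.2])).ne'
    rw [hd, uFun, Complex.ofReal_div]
    field_simp
  have hu0 : ∀ x ∈ tildeSpec S, (uFun x : ℂ) - z ≠ 0 := fun x hx h0 => by
    have h1 : (uFun x : ℂ) ∈ pmapSpectrum T := (h.mem_spectrum_iff hsa hx.2).1 hx.1
    rw [sub_eq_zero.1 h0] at h1
    exact hz h1
  have hs0 : ∀ x ∈ tildeSpec S, (√(1 - x ^ 2) : ℂ) ≠ 0 := fun x hx =>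
    Complex.ofReal_ne_zero.2 (Real.sqrt_pos.2 (by nlinarith [hx.2.1, hx.2.2])).ne'
  have hd0 : ∀ x ∈ tildeSpec S, d x ≠ 0 := fun x hx => by
    rw [hd_eq x hx.2]
    exact mul_ne_zero (hs0 x hx) (hu0 x hx)
  have hzero : ∀ x ∉ tildeSpec S, compU p x = 0 := fun x hx => by
    obtain ⟨-, K, -, hKs, h0⟩ := hm
    exact h0 x fun hxK => hx (hKs hxK)
  set g : ℝ → ℂ := fun x => compU p x / d x with hg
  have hgm : MemCc g (tildeSpec S) := by
    obtain ⟨hc, K, hK, hKs, h0⟩ := hm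
    exact ⟨hc.div hdc.continuousOn hd0, K, hK, hKs, fun x hx => by simp [hg, h0 x hx]⟩
  have hgc := hgm.continuousOn_spectrum
  have e1 : pmapCalc S p = (S - z • R) * boundedCalc S g := by
    rw [← h.boundedCalc_sub_smul, ← boundedCalc_mul hS hdc.continuousOn hgc]
    refine boundedCalc_congr hS fun x _ => ?_
    by_cases hx : x ∈ tildeSpec S
    · exact (mul_div_cancel₀ _ (hd0 x hx)).symm
    · simp [hg, hzero x hx]
  have e2 : pmapCalc S (fun x => ((x : ℂ) - z)⁻¹ * p x) = R * boundedCalc S g := by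
    rw [← h.eq_boundedCalc, ← boundedCalc_mul hS (by fun_prop) hgc]
    refine boundedCalc_congr hS fun x hx => ?_
    by_cases hxI : x ∈ Set.Ioo (-1 : ℝ) 1
    · have h1 := hs0 x ⟨hx, hxI⟩
      have h2 := hu0 x ⟨hx, hxI⟩
      simp only [hg, compU, if_pos hxI]
      rw [hd_eq x hxI]
      field_simp
    · simp only [hg, compU, if_neg hxI, zero_div, mul_zero]
  rw [e1, e2, ← mul_assoc, h.leftInverse_mul hB]

end BoundedTransformData

/-- The restriction of a bounded operator to a dense subspace is closable, and its closure is
the operator itself. -/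
theorem ContinuousLinearMap.closure_toPMap_of_dense (B : H →L[ℂ] H) {D : Submodule ℂ H}
    (hD : Dense (D : Set H)) :
    ((B : H →ₗ[ℂ] H).toPMap D).IsClosable ∧
      ((B : H →ₗ[ℂ] H).toPMap D).closure = (B : H →ₗ[ℂ] H).toPMap ⊤ := by
  have hgraph : ((B : H →ₗ[ℂ] H).toPMap D).graph.topologicalClosure =
      ((B : H →ₗ[ℂ] H).toPMap ⊤).graph := by
    apply le_antisymm
    · refine Submodule.topologicalClosure_minimal _ ?_ ?_
      · rintro ⟨x, y⟩ hxy
        obtain ⟨v, rfl, rfl⟩ := (LinearPMap.mem_graph_iff _).1 hxy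
        exact (LinearPMap.mem_graph_iff _).2 ⟨⟨v, trivial⟩, rfl, rfl⟩
      · have e : (((B : H →ₗ[ℂ] H).toPMap ⊤).graph : Set (H × H)) = {q | B q.1 = q.2} := by
          ext ⟨x, y⟩
          constructor
          · intro hxy
            obtain ⟨v, rfl, rfl⟩ := (LinearPMap.mem_graph_iff _).1 hxy
            rfl
          · intro hxy
            exact (LinearPMap.mem_graph_iff _).2 ⟨⟨x, trivial⟩, rfl, hxy⟩
        rw [e]
        exact isClosed_eq (by fun_prop) continuous_snd
    · rintro ⟨x, y⟩ hxy
      obtain ⟨v, rfl, rfl⟩ := (LinearPMap.mem_graph_iff _).1 hxy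
      have hc : Continuous fun x : H => (x, B x) := by fun_prop
      refine map_mem_closure (f := fun x => (x, B x)) hc (hD (v : H)) fun x hx => ?_
      exact (LinearPMap.mem_graph_iff _).2 ⟨⟨x, hx⟩, rfl, rfl⟩
  have hcl : ((B : H →ₗ[ℂ] H).toPMap D).IsClosable := ⟨_, hgraph⟩
  exact ⟨hcl, LinearPMap.eq_of_eq_graph (hcl.graph_closure_eq_closure_graph.symm.trans hgraph)⟩

/-- For `z ∈ ρ(T)`, with `B = (T - z)⁻¹` the resolvent, the closure of the operator
`f₀(T)` on `C*_c(S)H` for `f(x) = (x - z)⁻¹` equals the resolvent `(T - z)⁻¹`. -/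
theorem resolvent_calc (T : H →ₗ.[ℂ] H) (S : H →L[ℂ] H)
    (hdense : Dense (T.domain : Set H)) (hsa : IsSelfAdjoint T)
    (hbt : IsBoundedTransform T S) (z : ℂ) (hz : z ∉ pmapSpectrum T) (B : H →L[ℂ] H)
    (hB1 : ∀ x : H, ∃ h : B x ∈ T.domain, (T ⟨B x, h⟩ : H) - z • B x = x)
    (hB2 : ∀ ψ : T.domain, B ((T ψ : H) - z • (ψ : H)) = ψ) :
    ∃ A : H →ₗ.[ℂ] H, IsF0 S (realSpec T) (fun x : ℝ => ((x : ℂ) - z)⁻¹) A ∧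
      A.IsClosable ∧ A.closure = (B : H →ₗ[ℂ] H).toPMap ⊤ := by
  obtain ⟨R, h⟩ := hbt.exists_data hsa
  refine ⟨(B : H →ₗ[ℂ] H).toPMap (ccSpan S), ⟨rfl, fun p hp ψ => ?_⟩,
    B.closure_toPMap_of_dense h.dense_ccSpan⟩
  refine ⟨Submodule.subset_span ⟨compU p, h.memCc_compU hsa hp, ψ, rfl⟩, ?_⟩
  exact congrArg (fun f => f ψ) (h.leftInverse_mul_pmapCalc hsa hz hB2 hp)
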